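/- Case 13 of Theorem 1.2: the hypergeometric group Γ(f,g) generated by the companion matrices A and B of f(x) = x^5 - 1 and g(x) = x^5 + 3x^4 + 5x^3 + 5x^2 + 3x + 1 is an arithmetic subgroup of the integral orthogonal group O_Q(ℤ): Γ(f,g) is contained in O_Q(ℤ) (in particular Aᵀ·Q·A = Q and Bᵀ·Q·B = Q), and Γ(f,g) has finite index in O_Q(ℤ). -/

import Mathlib

open Matrix

/-- The companion matrix `A` of `f(x) = x^5 - 1`. -/
def matA : Matrix (Fin 5) (Fin 5) ℤ :=
  !![(0 : ℤ), 0, 0, 0, 1; 1, 0, 0, 0, 0; 0, 1, 0, 0, 0; 0, 0, 1, 0, 0; 0, 0, 0, 1, 0]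

/-- The companion matrix `B` of `g(x) = x^5 + 3*x^4 + 5*x^3 + 5*x^2 + 3*x + 1`. -/
def matB : Matrix (Fin 5) (Fin 5) ℤ :=
  !![(0 : ℤ), 0, 0, 0, -1; 1, 0, 0, 0, -3; 0, 1, 0, 0, -5; 0, 0, 1, 0, -5; 0, 0, 0, 1, -3]

/-- The symmetric integer matrix `Q` of the quadratic form preserved by `Γ(f,g)`. -/
def matQ : Matrix (Fin 5) (Fin 5) ℤ :=
  !![(29 : ℤ), -25, 11, 11, -25; -25, 29, -25, 11, 11; 11, -25, 29, -25, 11; 11, 11, -25, 29, -25; -25, 11, 11, -25, 29]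

/-- The integral orthogonal group `O_Q(ℤ)` of a matrix `Q`, as the subgroup of `GL₅(ℤ)`
consisting of all `M` with `Mᵀ * Q * M = Q`. -/
def orthogonalSubgroup (Q : Matrix (Fin 5) (Fin 5) ℤ) : Subgroup (GL (Fin 5) ℤ) where
  carrier := { M : GL (Fin 5) ℤ |
      (M : Matrix (Fin 5) (Fin 5) ℤ)ᵀ * Q * (M : Matrix (Fin 5) (Fin 5) ℤ) = Q }
  one_mem' := by simp
  mul_mem' := by
    intro a b ha hb
    simp only [Set.mem_setOf_eq, Units.val_mul, transpose_mul] at ha hb ⊢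
    calc ((b : Matrix (Fin 5) (Fin 5) ℤ)ᵀ * (a : Matrix (Fin 5) (Fin 5) ℤ)ᵀ) * Q *
          ((a : Matrix (Fin 5) (Fin 5) ℤ) * (b : Matrix (Fin 5) (Fin 5) ℤ))
        = (b : Matrix (Fin 5) (Fin 5) ℤ)ᵀ *
            ((a : Matrix (Fin 5) (Fin 5) ℤ)ᵀ * Q * (a : Matrix (Fin 5) (Fin 5) ℤ)) *
            (b : Matrix (Fin 5) (Fin 5) ℤ) := by
          simp only [mul_assoc]
      _ = Q := by rw [ha, hb]
  inv_mem' := by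
    intro a ha
    simp only [Set.mem_setOf_eq] at ha ⊢
    calc ((a⁻¹ : GL (Fin 5) ℤ) : Matrix (Fin 5) (Fin 5) ℤ)ᵀ * Q *
          ((a⁻¹ : GL (Fin 5) ℤ) : Matrix (Fin 5) (Fin 5) ℤ)
        = ((a⁻¹ : GL (Fin 5) ℤ) : Matrix (Fin 5) (Fin 5) ℤ)ᵀ *
            ((a : Matrix (Fin 5) (Fin 5) ℤ)ᵀ * Q * (a : Matrix (Fin 5) (Fin 5) ℤ)) *
            ((a⁻¹ : GL (Fin 5) ℤ) : Matrix (Fin 5) (Fin 5) ℤ) := by rw [ha]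
      _ = ((a : Matrix (Fin 5) (Fin 5) ℤ) *
            ((a⁻¹ : GL (Fin 5) ℤ) : Matrix (Fin 5) (Fin 5) ℤ))ᵀ * Q *
          ((a : Matrix (Fin 5) (Fin 5) ℤ) *
            ((a⁻¹ : GL (Fin 5) ℤ) : Matrix (Fin 5) (Fin 5) ℤ)) := by
          simp only [transpose_mul, mul_assoc]
      _ = Q := by rw [Units.mul_inv]; simp

namespace Hyp

abbrev M5 := Matrix (Fin 5) (Fin 5) ℤ
abbrev V5 := Fin 5 → ℤ

/-- The Gram matrix of the root lattice; `matQ * gram = 18`. -/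
def gram : M5 :=
  !![2, 3, 5, 5, 3; 3, 2, 3, 5, 5; 5, 3, 2, 3, 5; 5, 5, 3, 2, 3; 3, 5, 5, 3, 2]

lemma gram_symm : gramᵀ = gram := by decide +kernel

lemma matQ_gram : matQ * gram = (18 : ℤ) • (1 : M5) := by decide +kernel

lemma gram_matQ : gram * matQ = (18 : ℤ) • (1 : M5) := by decide +kernel

/-- Membership in `O_Q(ℤ)` in terms of the Gram matrix. -/
lemma mem_orth_iff (g : GL (Fin 5) ℤ) :
    g ∈ orthogonalSubgroup matQ ↔ g.val * gram * g.valᵀ = gram := by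
  change g.valᵀ * matQ * g.val = matQ ↔ _
  have key : ∀ X Y : M5, X * Y = (18 : ℤ) • (1 : M5) → Y * X = (18 : ℤ) • (1 : M5) →
      ∀ (M N : M5), M * N = 1 → N * M = 1 → Mᵀ * X * M = X → M * Y * Mᵀ = Y := by
    intro X Y hXY hYX M N hMN hNM h
    have h1 : Mᵀ * Nᵀ = 1 := by rw [← transpose_mul, hNM, transpose_one]
    have h1' : Nᵀ * Mᵀ = 1 := by rw [← transpose_mul, hMN, transpose_one]
    have h2 : X * M = Nᵀ * X := by
      calc X * M = (Nᵀ * Mᵀ) * (X * M) := by rw [h1', one_mul]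
        _ = Nᵀ * (Mᵀ * X * M) := by simp only [mul_assoc]
        _ = Nᵀ * X := by rw [h]
    have h3 : (18 : ℤ) • (M * Y * Mᵀ) = (18 : ℤ) • Y := by
      calc (18 : ℤ) • (M * Y * Mᵀ) = ((18 : ℤ) • (1 : M5)) * (M * Y * Mᵀ) := by simp
        _ = Y * (X * M) * Y * Mᵀ := by rw [← hYX]; simp only [mul_assoc]
        _ = Y * Nᵀ * (X * Y) * Mᵀ := by rw [h2]; simp only [mul_assoc]
        _ = (18 : ℤ) • (Y * (Nᵀ * Mᵀ)) := by
          rw [hXY, mul_smul_comm, mul_one, smul_mul_assoc, mul_assoc]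
        _ = (18 : ℤ) • Y := by rw [h1', mul_one]
    exact smul_right_injective _ (by norm_num : (18 : ℤ) ≠ 0) h3
  constructor
  · exact key _ _ matQ_gram gram_matQ _ _ g.mul_inv g.inv_mul
  · intro h
    have h1 : g.val * g⁻¹.val = 1 := g.mul_inv
    have h2 : g⁻¹.val * g.val = 1 := g.inv_mul
    have := key gram matQ gram_matQ matQ_gram g.valᵀ g⁻¹.valᵀ
      (by rw [← transpose_mul, h2, transpose_one]) (by rw [← transpose_mul, h1, transpose_one])
      (by rw [transpose_transpose]; exact h)
    rwa [transpose_transpose] at this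

/-- `M` is the matrix of an element of `H`. -/
def InH (H : Subgroup (GL (Fin 5) ℤ)) (M : M5) : Prop := ∃ g ∈ H, g.val = M

variable {H H' : Subgroup (GL (Fin 5) ℤ)}

lemma InH.mul {X Y : M5} (hX : InH H X) (hY : InH H Y) : InH H (X * Y) := by
  obtain ⟨g, hg, rfl⟩ := hX
  obtain ⟨h, hh, rfl⟩ := hY
  exact ⟨g * h, H.mul_mem hg hh, rfl⟩

lemma InH.inv {X Y : M5} (hX : InH H X) (h : X * Y = 1) : InH H Y := by
  obtain ⟨g, hg, rfl⟩ := hX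
  refine ⟨g⁻¹, H.inv_mem hg, ?_⟩
  calc g⁻¹.val = g⁻¹.val * (g.val * Y) := by rw [h, mul_one]
    _ = (g⁻¹ * g).val * Y := by rw [Units.val_mul, mul_assoc]
    _ = Y := by simp

lemma InH.mono {X : M5} (hX : InH H X) (h : H ≤ H') : InH H' X := by
  obtain ⟨g, hg, rfl⟩ := hX
  exact ⟨g, h hg, rfl⟩

lemma InH.one : InH H 1 := ⟨1, H.one_mem, rfl⟩

lemma InH.of_mem {g : GL (Fin 5) ℤ} (h : g ∈ H) : InH H g.val := ⟨g, h, rfl⟩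

lemma InH.mem {g : GL (Fin 5) ℤ} (h : InH H g.val) : g ∈ H := by
  obtain ⟨k, hk, hkg⟩ := h
  rwa [Units.ext hkg] at hk

/-- Reflection matrix (acting on row vectors) in a vector `r` of norm `2 k`, `k = ±1`. -/
def S (k : ℤ) (r : V5) : M5 := 1 - k • vecMulVec (gram *ᵥ r) r

/-- The cyclic permutation matrices. -/
def shM (k : Fin 5) : M5 := Matrix.of fun i j => if j = i + k then 1 else 0

/-- Isometries conjugate reflections to reflections. -/
lemma S_conj (k : ℤ) (r : V5) (X : M5) (hX : X * gram * Xᵀ = gram) :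
    S k r * X = X * S k (r ᵥ* X) := by
  have h : X *ᵥ (gram *ᵥ (r ᵥ* X)) = gram *ᵥ r := by
    rw [← mulVec_transpose, mulVec_mulVec, mulVec_mulVec, hX]
  unfold S
  rw [sub_mul, mul_sub, one_mul, mul_one, smul_mul_assoc, mul_smul_comm]
  congr 2
  rw [vecMulVec_mul, mul_vecMulVec, h]

lemma S_neg (k : ℤ) (r : V5) : S k (-r) = S k r := by
  unfold S; simp [mulVec_neg]

/-- The main derivation rule. -/
lemma derive (hO : H ≤ orthogonalSubgroup matQ) {k : ℤ} {a b : V5} {X : M5} (hX : InH H X)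
    (ha : InH H (S k a)) (h : a ᵥ* X = b ∨ a ᵥ* X = -b) : InH H (S k b) := by
  have hb : S k b = S k (a ᵥ* X) := by
    rcases h with h | h <;> rw [h]
    rw [S_neg]
  obtain ⟨x, hx, rfl⟩ := hX
  obtain ⟨g, hg, hga⟩ := ha
  refine ⟨x⁻¹ * g * x, H.mul_mem (H.mul_mem (H.inv_mem hx) hg) hx, ?_⟩
  have hiso := (mem_orth_iff x).1 (hO hx)
  rw [hb, mul_assoc, Units.val_mul, Units.val_mul, hga, S_conj _ _ _ hiso, ← mul_assoc,
    ← Units.val_mul]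
  simp

/-- derivation rule with shifts: shift `a`, reflect in `s`, shift. -/
lemma derive_refl (hO : H ≤ orthogonalSubgroup matQ) (hsh : ∀ i, InH H (shM i))
    {k l : ℤ} {a s : V5} (ha : InH H (S k a)) (hs : InH H (S l s)) (i j : Fin 5) (b : V5)
    (h : ((a ᵥ* shM i) ᵥ* S l s) ᵥ* shM j = b ∨ ((a ᵥ* shM i) ᵥ* S l s) ᵥ* shM j = -b) :
    InH H (S k b) := by
  refine derive hO (((hsh i).mul hs).mul (hsh j)) ha ?_
  rw [← vecMul_vecMul, ← vecMul_vecMul]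
  exact h

lemma derive_shift (hO : H ≤ orthogonalSubgroup matQ) (hsh : ∀ i, InH H (shM i))
    {k : ℤ} {a : V5} (ha : InH H (S k a)) (i : Fin 5) (b : V5)
    (h : a ᵥ* shM i = b ∨ a ᵥ* shM i = -b) : InH H (S k b) :=
  derive hO (hsh i) ha h

/-! ### Finite index from finitely many right cosets -/

lemma relIndex_ne_zero_of_cosets {G : Type*} [Group G] (H : Subgroup G) (s T : Set G)
    (hT : T.Finite) (h1 : (1 : G) ∈ T)
    (hs : ∀ t ∈ T, ∀ g ∈ s, (∃ h ∈ H, ∃ t' ∈ T, t * g = h * t') ∧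
      (∃ h ∈ H, ∃ t' ∈ T, t * g⁻¹ = h * t')) :
    H.relIndex (Subgroup.closure s) ≠ 0 := by
  have key : ∀ g ∈ Subgroup.closure s, ∃ h ∈ H, ∃ t ∈ T, g = h * t := by
    intro g hg
    induction hg using Subgroup.closure_induction_right with
    | one => exact ⟨1, H.one_mem, 1, h1, by simp⟩
    | mul_right x hx y hy ih =>
      obtain ⟨h, hh, t, ht, rfl⟩ := ih
      obtain ⟨h', hh', t', ht', e⟩ := (hs t ht y hy).1
      exact ⟨h * h', H.mul_mem hh hh', t', ht', by rw [mul_assoc, e, mul_assoc]⟩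
    | mul_inv_cancel x hx y hy ih =>
      obtain ⟨h, hh, t, ht, rfl⟩ := ih
      obtain ⟨h', hh', t', ht', e⟩ := (hs t ht y hy).2
      exact ⟨h * h', H.mul_mem hh hh', t', ht', by rw [mul_assoc, e, mul_assoc]⟩
  have : Finite T := hT
  choose! h hh t ht e using key
  have hfin : Finite (Subgroup.closure s ⧸ H.subgroupOf (Subgroup.closure s)) := by
    refine Finite.of_injective (β := T)
      (fun q => ⟨t ((q.out : Subgroup.closure s) : G)⁻¹, ht _ (inv_mem q.out.2)⟩) ?_
    intro q q' hqq
    simp only [Subtype.mk.injEq] at hqq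
    rw [← q.out_eq, ← q'.out_eq]
    apply QuotientGroup.eq.2
    rw [Subgroup.mem_subgroupOf]
    have e1 := e _ (inv_mem q.out.2)
    have e2 := e _ (inv_mem q'.out.2)
    have h1 := hh _ (inv_mem q.out.2)
    have h2 := hh _ (inv_mem q'.out.2)
    rw [← hqq] at e2
    have : (((q.out)⁻¹ * q'.out : Subgroup.closure s) : G)
        = h ((q.out : Subgroup.closure s) : G)⁻¹ * (h ((q'.out : Subgroup.closure s) : G)⁻¹)⁻¹ := by
      have key : ∀ x y a b c : G, x⁻¹ = a * c → y⁻¹ = b * c → x⁻¹ * y = a * b⁻¹ := by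
        intro x y a b c hx hy
        rw [hx, ← inv_inv y, hy]; group
      rw [Subgroup.coe_mul, Subgroup.coe_inv]
      exact key _ _ _ _ _ e1 e2
    rw [this]
    exact H.mul_mem h1 (H.inv_mem h2)
  exact (Subgroup.index_ne_zero_of_finite (H := H.subgroupOf (Subgroup.closure s)))

/-- Adjoining a normalizing involution. -/
lemma relIndex_insert {G : Type*} [Group G] (s : Set G) (g : G) (hg : g * g = 1)
    (hn : ∀ x ∈ s, g * x * g ∈ Subgroup.closure s) :
    (Subgroup.closure s).relIndex (Subgroup.closure (insert g s)) ≠ 0 := by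
  have hgi : g⁻¹ = g := inv_eq_of_mul_eq_one_left hg
  have hx' : ∀ x ∈ s, g * x⁻¹ * g ∈ Subgroup.closure s := by
    intro x hx
    have := (Subgroup.closure s).inv_mem (hn x hx)
    rwa [_root_.mul_inv_rev, _root_.mul_inv_rev, hgi, ← mul_assoc] at this
  refine relIndex_ne_zero_of_cosets _ _ {1, g} (by simp) (by simp) ?_
  have hm : ∀ x ∈ s, x ∈ Subgroup.closure s := fun x hx => Subgroup.subset_closure hx
  have h1m := (Subgroup.closure s).one_mem
  rintro t (rfl | rfl) x (rfl | hx)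
  · rw [hgi]
    exact ⟨⟨1, h1m, x, by simp, rfl⟩, ⟨1, h1m, x, by simp, rfl⟩⟩
  · exact ⟨⟨x, hm x hx, 1, by simp, by simp⟩,
      ⟨x⁻¹, inv_mem (hm x hx), 1, by simp, by simp⟩⟩
  · rw [hgi]
    exact ⟨⟨1, h1m, 1, by simp, by simpa using hg⟩, ⟨1, h1m, 1, by simp, by simpa using hg⟩⟩
  · exact ⟨⟨_, hn x hx, t, by simp, by rw [mul_assoc _ t t, hg, mul_one]⟩,
      ⟨_, hx' x hx, t, by simp, by rw [mul_assoc _ t t, hg, mul_one]⟩⟩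


/-! ### The groups -/

/-- An involutive matrix as an element of `GL₅(ℤ)`. -/
def mkU (M : M5) (h : M * M = 1) : GL (Fin 5) ℤ := ⟨M, M, h, h⟩

def vrho : V5 := ![2, -2, 1, 0, -1]
def vbet : V5 := ![-1, 1, -1, 1, -1]
def vsig : V5 := ![0, 0, -1, 2, -1]

def uA : GL (Fin 5) ℤ := ⟨shM 4, shM 1, by decide +kernel, by decide +kernel⟩
def uC : GL (Fin 5) ℤ := mkU (S 1 ![0, 0, 0, 0, 1]) (by decide +kernel)
def uR : GL (Fin 5) ℤ := mkU (S 1 vrho) (by decide +kernel)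
def uBet : GL (Fin 5) ℤ := mkU (S 1 vbet) (by decide +kernel)
def uSig : GL (Fin 5) ℤ := mkU (S (-1) vsig) (by decide +kernel)

def s0 : Set (GL (Fin 5) ℤ) := {uA, uC}
def s1 : Set (GL (Fin 5) ℤ) := insert uR s0
def s2 : Set (GL (Fin 5) ℤ) := insert uBet s1
def s3 : Set (GL (Fin 5) ℤ) := insert uSig s2
def s4 : Set (GL (Fin 5) ℤ) := insert (-1) s3

def H0 := Subgroup.closure s0
def H1 := Subgroup.closure s1
def H2 := Subgroup.closure s2
def H3 := Subgroup.closure s3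
def H4 := Subgroup.closure s4

lemma H01 : H0 ≤ H1 := Subgroup.closure_mono (Set.subset_insert _ _)
lemma H12 : H1 ≤ H2 := Subgroup.closure_mono (Set.subset_insert _ _)
lemma H23 : H2 ≤ H3 := Subgroup.closure_mono (Set.subset_insert _ _)
lemma H34 : H3 ≤ H4 := Subgroup.closure_mono (Set.subset_insert _ _)
lemma H14 : H1 ≤ H4 := H12.trans (H23.trans H34)

lemma H4_le : H4 ≤ orthogonalSubgroup matQ := by
  refine (Subgroup.closure_le _).2 ?_
  rintro x (rfl | rfl | rfl | rfl | rfl | rfl) <;> refine (mem_orth_iff _).2 ?_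
  · simp
  · change S (-1) vsig * gram * (S (-1) vsig)ᵀ = gram
    decide +kernel
  · change S 1 vbet * gram * (S 1 vbet)ᵀ = gram
    decide +kernel
  · change S 1 vrho * gram * (S 1 vrho)ᵀ = gram
    decide +kernel
  · change shM 4 * gram * (shM 4)ᵀ = gram
    decide +kernel
  · change S 1 ![0, 0, 0, 0, 1] * gram * (S 1 ![0, 0, 0, 0, 1])ᵀ = gram
    decide +kernel

lemma H1_le : H1 ≤ orthogonalSubgroup matQ := H14.trans H4_le
lemma H0_le : H0 ≤ orthogonalSubgroup matQ := H01.trans H1_le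

lemma H0_sh4 : InH H0 (shM 4) :=
  InH.of_mem (g := uA) (Subgroup.subset_closure (by simp [s0]))

lemma H0_sh (i : Fin 5) : InH H0 (shM i) := by
  have h3 : InH H0 (shM 3) := by
    rw [show shM 3 = shM 4 * shM 4 by decide +kernel]; exact H0_sh4.mul H0_sh4
  have h2 : InH H0 (shM 2) := by
    rw [show shM 2 = shM 3 * shM 4 by decide +kernel]; exact h3.mul H0_sh4
  have h1 : InH H0 (shM 1) := by
    rw [show shM 1 = shM 2 * shM 4 by decide +kernel]; exact h2.mul H0_sh4
  have h0 : InH H0 (shM 0) := by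
    rw [show shM 0 = shM 1 * shM 4 by decide +kernel]; exact h1.mul H0_sh4
  have h4 := H0_sh4
  fin_cases i <;> assumption

lemma H1_sh (i : Fin 5) : InH H1 (shM i) := (H0_sh i).mono H01
lemma H4_sh (i : Fin 5) : InH H4 (shM i) := (H1_sh i).mono H14

lemma g_e4 : InH H0 (S 1 ![0, 0, 0, 0, 1]) :=
  InH.of_mem (g := uC) (Subgroup.subset_closure (by simp [s0]))

lemma g_e0 : InH H0 (S 1 ![1, 0, 0, 0, 0]) :=
  derive_shift H0_le H0_sh g_e4 1 _ (by decide +kernel)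

lemma w_rho : InH H1 (S 1 ![2, -2, 1, 0, -1]) :=
  InH.of_mem (g := uR) (Subgroup.subset_closure (by simp [s1]))

lemma w_rho0 : InH H1 (S 1 ![2, -1, 0, 1, -2]) :=
  derive_shift H1_le H1_sh w_rho 4 _ (by decide +kernel)

/-! ### Reflections in `H0` -/

lemma g_3000m1 : InH H0 (S 1 ![3, 0, 0, 0, -1]) :=
  derive_refl H0_le H0_sh g_e0 g_e0 4 0 _ (by decide +kernel)

lemma g_3m1000 : InH H0 (S 1 ![3, -1, 0, 0, 0]) :=
  derive_refl H0_le H0_sh g_e0 g_e0 1 0 _ (by decide +kernel)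

lemma g_6m201m3 : InH H0 (S 1 ![6, -2, 0, 1, -3]) :=
  derive_refl H0_le H0_sh g_3000m1 g_3m1000 4 0 _ (by decide +kernel)

lemma g_3m201m2 : InH H0 (S 1 ![3, -2, 0, 1, -2]) :=
  derive_refl H0_le H0_sh g_3000m1 g_6m201m3 0 0 _ (by decide +kernel)

lemma g_4m201m2 : InH H0 (S 1 ![4, -2, 0, 1, -2]) :=
  derive_refl H0_le H0_sh g_e0 g_3m201m2 0 0 _ (by decide +kernel)

lemma g_6m310m2 : InH H0 (S 1 ![6, -3, 1, 0, -2]) :=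
  derive_refl H0_le H0_sh g_3m1000 g_3000m1 1 0 _ (by decide +kernel)

lemma g_3m210m2 : InH H0 (S 1 ![3, -2, 1, 0, -2]) :=
  derive_refl H0_le H0_sh g_3m1000 g_6m310m2 0 0 _ (by decide +kernel)

lemma g_2m1m12m2 : InH H0 (S 1 ![2, -1, -1, 2, -2]) :=
  derive_refl H0_le H0_sh g_3m210m2 g_3m201m2 1 1 _ (by decide +kernel)

lemma g_4m210m2 : InH H0 (S 1 ![4, -2, 1, 0, -2]) :=
  derive_refl H0_le H0_sh g_e0 g_3m210m2 0 0 _ (by decide +kernel)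

lemma g_4m2m24m3 : InH H0 (S 1 ![4, -2, -2, 4, -3]) :=
  derive_refl H0_le H0_sh g_e0 g_2m1m12m2 4 0 _ (by decide +kernel)

/-! ### Reflections in `H1` -/

lemma w_4m32m1m2 : InH H1 (S 1 ![4, -3, 2, -1, -2]) :=
  derive_refl H1_le H1_sh w_rho0 (g_3m210m2.mono H01) 0 0 _ (by decide +kernel)

lemma w_2001m2 : InH H1 (S 1 ![2, 0, 0, 1, -2]) :=
  derive_refl H1_le H1_sh (g_e0.mono H01) w_rho0 1 0 _ (by decide +kernel)

lemma w_2m1m22m2 : InH H1 (S 1 ![2, -1, -2, 2, -2]) :=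
  derive_refl H1_le H1_sh (g_e0.mono H01) (g_2m1m12m2.mono H01) 2 0 _ (by decide +kernel)

lemma w_4m201m3 : InH H1 (S 1 ![4, -2, 0, 1, -3]) :=
  derive_refl H1_le H1_sh (g_e0.mono H01) (g_4m201m2.mono H01) 4 0 _ (by decide +kernel)

lemma w_4m310m2 : InH H1 (S 1 ![4, -3, 1, 0, -2]) :=
  derive_refl H1_le H1_sh (g_e0.mono H01) (g_4m210m2.mono H01) 1 0 _ (by decide +kernel)


/-! ### `H0` has finite index in `H1` -/

/-- The key relation: `ρ C = h ρ A³` with `h ∈ H0`. -/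
def hk : M5 := !![6, -6, 0, 1, -3; 12, -12, 1, 0, -5; 14, -14, 2, -2, -5; 6, -5, 0, 0, -3; -1, 2, -2, 2, -1]

lemma hk_mem : InH H0 hk := by
  have h6 : InH H0 _ := derive_shift H0_le H0_sh g_3m210m2 1 ![2, -3, 2, -1, 0] (by decide +kernel)
  have h5 : InH H0 _ := derive_shift H0_le H0_sh g_4m2m24m3 3 ![2, -4, 3, -4, 2] (by decide +kernel)
  have h4 : InH H0 _ := derive_shift H0_le H0_sh g_4m201m2 3 ![0, 1, -2, 4, -2] (by decide +kernel)
  have h3 : InH H0 _ := derive_shift H0_le H0_sh g_4m210m2 3 ![1, 0, -2, 4, -2] (by decide +kernel)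
  have h0 : InH H0 _ := derive_shift H0_le H0_sh g_2m1m12m2 3 ![-1, 2, -2, 2, -1] (by decide +kernel)
  have := (((h6.mul h5).mul (h4.mul h3)).mul ((H0_sh 3).mul h0))
  have e : shM 2 * hk = S 1 ![2, -3, 2, -1, 0] * S 1 ![2, -4, 3, -4, 2] * (S 1 ![0, 1, -2, 4, -2] * S 1 ![1, 0, -2, 4, -2]) *
      (shM 3 * S 1 ![-1, 2, -2, 2, -1]) := by
    rw [← show (!![15, -28, 21, -28, 14; 8, -16, 13, -19, 10; 0, -2, 3, -6, 4; 4, -7, 5, -4, 2; 10, -18, 13, -14, 7] : M5) = S 1 ![2, -3, 2, -1, 0] * S 1 ![2, -4, 3, -4, 2] by decide +kernel,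
      ← show (!![16, -7, -16, 32, -16; 11, -5, -10, 20, -10; 0, -1, 3, -4, 2; 2, -1, -2, 5, -2; 8, -3, -10, 20, -9] : M5) = S 1 ![0, 1, -2, 4, -2] * S 1 ![1, 0, -2, 4, -2] by decide +kernel,
      ← show (!![0, 0, 0, 1, 0; 1, -2, 2, -2, 2; 2, -2, 2, -2, 1; 0, 1, 0, 0, 0; -2, 4, -3, 4, -2] : M5) = shM 3 * S 1 ![-1, 2, -2, 2, -1] by decide +kernel]
    decide +kernel
  rw [← e] at this
  have h2 := (H0_sh 3).mul this
  rwa [← mul_assoc, show shM 3 * shM 2 = 1 by decide +kernel, one_mul] at h2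

lemma rho_C : S 1 vrho * S 1 ![0, 0, 0, 0, 1] = hk * (S 1 vrho * shM 2) := by decide +kernel
lemma rho_A2_C : hk * (S 1 vrho * shM 2 * S 1 ![0, 0, 0, 0, 1]) = S 1 vrho := by
  rw [← mul_assoc, ← rho_C, mul_assoc, show S 1 ![0, 0, 0, 0, 1] * S 1 ![0, 0, 0, 0, 1] = 1 by
    decide +kernel, mul_one]

/-- Right coset representatives of `H0` in `H1`. -/
def cosetRep (i : Fin 5) : GL (Fin 5) ℤ :=
  ⟨S 1 vrho * shM i, shM (-i) * S 1 vrho, by revert i; decide +kernel, by revert i; decide +kernel⟩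

def cosetSet : Set (GL (Fin 5) ℤ) := insert 1 (Set.range cosetRep)

lemma coset_step {x : GL (Fin 5) ℤ} (i j : Fin 5) {X : M5} (hX : InH H0 X)
    (h : S 1 vrho * shM i * x.val = X * (S 1 vrho * shM j)) :
    ∃ h ∈ H0, ∃ t' ∈ cosetSet, cosetRep i * x = h * t' := by
  obtain ⟨g, hg, rfl⟩ := hX
  exact ⟨g, hg, cosetRep j, by simp [cosetSet], Units.ext h⟩

lemma shM_mul (i j : Fin 5) : shM i * shM j = shM (i + j) := by
  revert i j; decide +kernel

lemma step_C (i : Fin 5) : ∃ h ∈ H0, ∃ t' ∈ cosetSet, cosetRep i * uC = h * t' := by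
  have e3 : InH H0 _ := derive_shift H0_le H0_sh g_e0 3 ![0, 0, 0, 1, 0] (by decide +kernel)
  have e1 : InH H0 _ := derive_shift H0_le H0_sh g_e0 1 ![0, 1, 0, 0, 0] (by decide +kernel)
  fin_cases i
  · refine coset_step 0 2 hk_mem ?_
    rw [show shM 0 = 1 by decide +kernel, mul_one]; exact rho_C
  · exact coset_step 1 1 e3 (by change _ * S 1 ![0, 0, 0, 0, 1] = _; decide +kernel)
  · obtain ⟨g, hg, hgk⟩ := hk_mem
    refine coset_step 2 0 (X := g⁻¹.val) (InH.of_mem (H0.inv_mem hg)) ?_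
    have h := rho_A2_C
    rw [← hgk] at h
    rw [show shM 0 = 1 by decide +kernel, mul_one]
    calc S 1 vrho * shM 2 * uC.val
        = (g⁻¹ * g).val * (S 1 vrho * shM 2 * S 1 ![0, 0, 0, 0, 1]) := by
          rw [inv_mul_cancel, Units.val_one, one_mul]; rfl
      _ = g⁻¹.val * S 1 vrho := by rw [Units.val_mul, mul_assoc, h]
  · exact coset_step 3 3 e1 (by change _ * S 1 ![0, 0, 0, 0, 1] = _; decide +kernel)
  · exact coset_step 4 4 g_e0 (by change _ * S 1 ![0, 0, 0, 0, 1] = _; decide +kernel)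

lemma step_R (i : Fin 5) : ∃ h ∈ H0, ∃ t' ∈ cosetSet, cosetRep i * uR = h * t' := by
  have r1 : InH H0 _ := derive_shift H0_le H0_sh g_3m210m2 1 ![2, -3, 2, -1, 0] (by decide +kernel)
  have r2 : InH H0 _ := derive_shift H0_le H0_sh g_2m1m12m2 3 ![-1, 2, -2, 2, -1] (by decide +kernel)
  have r3 : InH H0 _ := derive_shift H0_le H0_sh g_2m1m12m2 0 ![-2, 1, 1, -2, 2] (by decide +kernel)
  have r4 : InH H0 _ := derive_shift H0_le H0_sh g_3m201m2 0 ![3, -2, 0, 1, -2] (by decide +kernel)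
  fin_cases i
  · refine ⟨1, H0.one_mem, 1, by simp [cosetSet], Units.ext ?_⟩
    change S 1 vrho * shM 0 * S 1 vrho = 1 * 1
    decide +kernel
  · exact coset_step 1 1 r1 (by change _ * S 1 vrho = _; decide +kernel)
  · exact coset_step 2 2 r2 (by change _ * S 1 vrho = _; decide +kernel)
  · exact coset_step 3 3 r3 (by change _ * S 1 vrho = _; decide +kernel)
  · exact coset_step 4 4 r4 (by change _ * S 1 vrho = _; decide +kernel)

lemma step_one {x : GL (Fin 5) ℤ} (hx : x ∈ H0) : ∃ h ∈ H0, ∃ t' ∈ cosetSet, 1 * x = h * t' :=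
  ⟨x, hx, 1, by simp [cosetSet], by simp⟩

lemma step_one_R : ∃ h ∈ H0, ∃ t' ∈ cosetSet, 1 * uR = h * t' := by
  refine ⟨1, H0.one_mem, cosetRep 0, by simp [cosetSet], Units.ext ?_⟩
  change 1 * S 1 vrho = 1 * (S 1 vrho * shM 0)
  decide +kernel

lemma uC_inv : uC⁻¹ = uC := rfl
lemma uR_inv : uR⁻¹ = uR := rfl

lemma relIndex01 : H0.relIndex H1 ≠ 0 := by
  have hA : uA ∈ H0 := Subgroup.subset_closure (by simp [s0])
  have hC : uC ∈ H0 := Subgroup.subset_closure (by simp [s0])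
  refine relIndex_ne_zero_of_cosets H0 s1 cosetSet ((Set.finite_range _).insert _)
    (by simp [cosetSet]) ?_
  rintro t (rfl | ⟨i, rfl⟩) x (rfl | rfl | rfl)
  · rw [uR_inv]; exact ⟨step_one_R, step_one_R⟩
  · exact ⟨step_one hA, step_one (H0.inv_mem hA)⟩
  · exact ⟨step_one hC, step_one (H0.inv_mem hC)⟩
  · rw [uR_inv]; exact ⟨step_R i, step_R i⟩
  · refine ⟨coset_step i (i + 4) InH.one ?_, coset_step i (i + 1) InH.one ?_⟩
    · change S 1 vrho * shM i * shM 4 = _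
      rw [mul_assoc, shM_mul, one_mul]
    · change S 1 vrho * shM i * shM 1 = _
      rw [mul_assoc, shM_mul, one_mul]
  · rw [uC_inv]; exact ⟨step_C i, step_C i⟩

/-! ### The remaining steps of the chain -/

lemma conj_refl {H : Subgroup (GL (Fin 5) ℤ)} {X : M5} {k : ℤ} {r b : V5}
    (hX : X * X = 1) (hiso : X * gram * Xᵀ = gram) (hr : r ᵥ* X = b) (hb : InH H (S k b)) :
    InH H (X * S k r * X) := by
  rw [mul_assoc, S_conj _ _ _ hiso, ← mul_assoc, hX, one_mul, hr]
  exact hb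

lemma relIndex12 : H1.relIndex H2 ≠ 0 := by
  have hX : S 1 vbet * S 1 vbet = 1 := by decide +kernel
  have hiso : S 1 vbet * gram * (S 1 vbet)ᵀ = gram := by decide +kernel
  refine relIndex_insert s1 uBet (Units.ext hX) ?_
  rintro x (rfl | rfl | rfl) <;> refine InH.mem (H := H1) ?_
  · have h : InH H1 _ := derive_shift H1_le H1_sh w_rho0 1 ![2, -2, 1, 0, -1] (by decide +kernel)
    exact conj_refl hX hiso (by decide +kernel) h
  · have h : InH H1 _ := derive_shift H1_le H1_sh w_2m1m22m2 4 ![-1, -2, 2, -2, 2] (by decide +kernel)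
    have := ((g_e0.mono H01).mul h).mul (H1_sh 4)
    rwa [show S 1 ![1, 0, 0, 0, 0] * S 1 ![-1, -2, 2, -2, 2] * shM 4 = S 1 vbet * shM 4 * S 1 vbet by
      decide +kernel] at this
  · have h : InH H1 _ := derive_shift H1_le H1_sh w_2m1m22m2 3 ![-2, 2, -2, 2, -1] (by decide +kernel)
    exact conj_refl hX hiso (by decide +kernel) h

lemma relIndex23 : H2.relIndex H3 ≠ 0 := by
  have hX : S (-1) vsig * S (-1) vsig = 1 := by decide +kernel
  have hiso : S (-1) vsig * gram * (S (-1) vsig)ᵀ = gram := by decide +kernel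
  refine relIndex_insert s2 uSig (Units.ext hX) ?_
  rintro x (rfl | rfl | rfl | rfl) <;> refine InH.mem (H := H2) ?_
  · have h : InH H2 (S 1 vbet) :=
      InH.of_mem (g := uBet) (Subgroup.subset_closure (by simp [s2]))
    exact conj_refl hX hiso (by decide +kernel) h
  · have h : InH H1 _ := derive_shift H1_le H1_sh w_rho0 1 ![2, -2, 1, 0, -1] (by decide +kernel)
    exact conj_refl hX hiso (by decide +kernel) (h.mono H12)
  · have h : InH H1 _ := derive_shift H1_le H1_sh w_4m201m3 4 ![-2, 0, 1, -3, 4] (by decide +kernel)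
    have h' : InH H1 _ := derive_shift H1_le H1_sh w_rho0 0 ![2, -1, 0, 1, -2] (by decide +kernel)
    have := (((H1_sh 2).mul h').mul (h.mul (H1_sh 4))).mono H12
    rwa [show shM 2 * S 1 ![2, -1, 0, 1, -2] * (S 1 ![-2, 0, 1, -3, 4] * shM 4) =
      S (-1) vsig * shM 4 * S (-1) vsig by decide +kernel] at this
  · have h : InH H1 _ := derive_shift H1_le H1_sh w_2001m2 4 ![0, 0, 1, -2, 2] (by decide +kernel)
    exact conj_refl hX hiso (by decide +kernel) (h.mono H12)

lemma relIndex34 : H3.relIndex H4 ≠ 0 := by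
  refine relIndex_insert s3 (-1) (by simp) ?_
  intro x hx
  simpa using Subgroup.subset_closure hx

lemma relIndex04 : H0.relIndex H4 ≠ 0 :=
  Subgroup.relIndex_ne_zero_trans
    (Subgroup.relIndex_ne_zero_trans (Subgroup.relIndex_ne_zero_trans relIndex01 relIndex12)
      relIndex23) relIndex34

/-! ### Change of basis -/

/-- A basis in which the form splits as a hyperbolic plane plus a ternary form. -/
def bas : M5 := !![1, -1, 0, 1, -1; 1, -1, 1, -1, 0; 2, -1, -1, 2, -1; 0, 1, -2, 3, -2; -1, 1, -1, 1, -1]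
def basInv : M5 := !![-1, 1, 0, 1, -1; -1, 1, -1, 2, -2; 1, 0, -2, 2, -3; 1, -1, -1, 1, -2; 0, -1, 0, 0, -1]
def gJ : M5 := !![0, 1, 0, 0, 0; 1, 0, 0, 0, 0; 0, 0, 0, 3, 0; 0, 0, 3, 2, 0; 0, 0, 0, 0, 2]

lemma bas_mul : bas * basInv = 1 := by decide +kernel
lemma basInv_mul : basInv * bas = 1 := by decide +kernel
lemma bas_gram : bas * gram * basᵀ = gJ := by decide +kernel

/-- `N` (in the new basis) comes from an element of `H4`. -/
def InK (N : M5) : Prop := InH H4 (basInv * N * bas)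

lemma InK.mul {X Y : M5} (hX : InK X) (hY : InK Y) : InK (X * Y) := by
  have := InH.mul hX hY
  rwa [show basInv * X * bas * (basInv * Y * bas) = basInv * X * (bas * basInv) * Y * bas by
    simp only [mul_assoc], bas_mul, mul_one, mul_assoc basInv X Y] at this

lemma InK.inv {X Y : M5} (hX : InK X) (h : X * Y = 1) : InK Y := by
  refine InH.inv hX ?_
  rw [show basInv * X * bas * (basInv * Y * bas) = basInv * X * (bas * basInv) * Y * bas by
    simp only [mul_assoc], bas_mul, mul_one, mul_assoc basInv X Y, h, mul_one, basInv_mul]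

lemma InK.one : InK 1 := by
  unfold InK; rw [mul_one, basInv_mul]; exact InH.one

lemma InK.of {X N : M5} (hX : InH H4 X) (h : basInv * N * bas = X) : InK N := by
  unfold InK; rwa [h]

lemma iso_iff (N X : M5) (h : basInv * N * bas = X) :
    N * gJ * Nᵀ = gJ ↔ X * gram * Xᵀ = gram := by
  have h1 : bas * X = N * bas := by
    rw [← h, ← mul_assoc, ← mul_assoc, bas_mul, one_mul]
  have h2 : N * gJ * Nᵀ = bas * (X * gram * Xᵀ) * basᵀ := by
    calc N * gJ * Nᵀ = (N * bas) * gram * (N * bas)ᵀ := by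
          rw [← bas_gram, transpose_mul]; simp only [mul_assoc]
      _ = _ := by rw [← h1, transpose_mul]; simp only [mul_assoc]
  rw [h2, ← bas_gram]
  constructor
  · intro h3
    have h4 : ∀ Z : M5, basInv * (bas * Z * basᵀ) * basInvᵀ = Z := by
      intro Z
      rw [show basInv * (bas * Z * basᵀ) * basInvᵀ = (basInv * bas) * Z * (basInv * bas)ᵀ by
        rw [transpose_mul]; simp only [mul_assoc], basInv_mul]
      simp
    rw [← h4 (X * gram * Xᵀ), h3, h4]
  · intro h3; rw [h3]

lemma InK.iso {N : M5} (h : InK N) : N * gJ * Nᵀ = gJ := by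
  refine (iso_iff N _ rfl).2 ?_
  obtain ⟨g, hg, hgN⟩ := h
  rw [← hgN]
  exact (mem_orth_iff g).1 (H4_le hg)

/-! ### Generators in the new basis -/

/-- Eichler transformations. -/
def NE (x y z : ℤ) : M5 :=
  !![1, 0, 0, 0, 0; -(3 * x * y + y ^ 2 + z ^ 2), 1, x, y, z; -3 * y, 0, 1, 0, 0;
    -3 * x - 2 * y, 0, 0, 1, 0; -2 * z, 0, 0, 0, 1]

/-- Parabolic elements fixing the isotropic line of the third basis vector. -/
def NT (k : ℤ) : M5 :=
  !![1, 0, 0, 0, 0; 0, 1, 0, 0, 0; 0, 0, 1, 0, 0; 0, 0, -3 * k ^ 2, 1, 3 * k; 0, 0, -2 * k, 0, 1]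

def NSwap : M5 := !![0, 1, 0, 0, 0; 1, 0, 0, 0, 0; 0, 0, 1, 0, 0; 0, 0, 0, 1, 0; 0, 0, 0, 0, 1]
def NNegH : M5 := !![-1, 0, 0, 0, 0; 0, -1, 0, 0, 0; 0, 0, 1, 0, 0; 0, 0, 0, 1, 0; 0, 0, 0, 0, 1]
def NNegM : M5 := !![1, 0, 0, 0, 0; 0, 1, 0, 0, 0; 0, 0, -1, 0, 0; 0, 0, 0, -1, 0; 0, 0, 0, 0, -1]
def NBet : M5 := !![1, 0, 0, 0, 0; 0, 1, 0, 0, 0; 0, 0, 1, 0, 0; 0, 0, 0, 1, 0; 0, 0, 0, 0, -1]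
def NB2 : M5 := !![1, 0, 0, 0, 0; 0, 1, 0, 0, 0; 0, 0, 1, -3, 0; 0, 0, 0, -1, 0; 0, 0, 0, 0, 1]
def Nt : M5 := !![1, 0, 0, 0, 0; 0, 1, 0, 0, 0; 0, 0, -2, 3, -3; 0, 0, 1, 0, 1; 0, 0, 2, -2, 3]

lemma NE_add (x y z x' y' z' : ℤ) :
    NE x y z * NE x' y' z' = NE (x + x') (y + y') (z + z') := by
  ext i j
  fin_cases i <;> fin_cases j <;> simp [NE, Matrix.mul_apply, Fin.sum_univ_five] <;> ring

lemma NT_add (k l : ℤ) : NT k * NT l = NT (k + l) := by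
  ext i j
  fin_cases i <;> fin_cases j <;> simp [NT, Matrix.mul_apply, Fin.sum_univ_five] <;> ring

lemma NE_zero : NE 0 0 0 = 1 := by decide +kernel
lemma NT_zero : NT 0 = 1 := by decide +kernel

lemma InK_zpow (F : ℤ → M5) (h0 : F 0 = 1) (hF : ∀ k l, F k * F l = F (k + l)) (h1 : InK (F 1))
    (k : ℤ) : InK (F k) := by
  have hn : ∀ n : ℕ, InK (F n) := by
    intro n
    induction n with
    | zero => simpa [h0] using InK.one
    | succ n ih => push_cast; rw [← hF]; exact ih.mul h1
  rcases Int.eq_nat_or_neg k with ⟨n, rfl | rfl⟩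
  · exact hn n
  · exact (hn n).inv (by rw [hF, add_neg_cancel, h0])

lemma k_bet : InH H4 (S 1 ![-1, 1, -1, 1, -1]) :=
  InH.of_mem (g := uBet) (Subgroup.subset_closure (by simp [s4, s3, s2]))

lemma k_sig : InH H4 (S (-1) ![0, 0, -1, 2, -1]) :=
  InH.of_mem (g := uSig) (Subgroup.subset_closure (by simp [s4, s3]))

lemma k_neg : InH H4 (-1) :=
  InH.of_mem (g := -1) (Subgroup.subset_closure (by simp [s4]))

lemma k_b2 : InH H4 (S 1 ![0, 1, -2, 3, -2]) := InH.mono (derive_shift H1_le H1_sh (g_3m201m2.mono H01) 3 ![0, 1, -2, 3, -2] (by decide +kernel)) H14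

lemma k_b13 : InH H4 (S 1 ![1, 0, -2, 3, -2]) := InH.mono (derive_shift H1_le H1_sh (g_3m210m2.mono H01) 3 ![1, 0, -2, 3, -2] (by decide +kernel)) H14

lemma NE_mem (x y z : ℤ) : InK (NE x y z) := by
  have h1 : InK (NE 0 1 0) :=
    InK.of ((InH.mono (derive_shift H1_le H1_sh w_4m310m2 3 ![1, 0, -2, 4, -3] (by decide +kernel)) H14).mul k_b2) (by decide +kernel)
  have h2 : InK (NE 0 0 1) :=
    InK.of ((InH.mono (derive_shift H1_le H1_sh w_2001m2 4 ![0, 0, -1, 2, -2] (by decide +kernel)) H14).mul k_bet) (by decide +kernel)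
  have h3 : InK (NE 1 0 1) :=
    InK.of ((InH.mono (derive_shift H1_le H1_sh w_4m32m1m2 3 ![2, -1, -2, 4, -3] (by decide +kernel)) H14).mul k_b13) (by decide +kernel)
  have e1 := InK_zpow (fun k => NE 0 k 0) NE_zero (fun k l => by rw [NE_add]; simp) h1 y
  have e2 := InK_zpow (fun k => NE 0 0 k) NE_zero (fun k l => by rw [NE_add]; simp) h2 (z - x)
  have e3 := InK_zpow (fun k => NE k 0 k) NE_zero (fun k l => by rw [NE_add]; simp) h3 x
  have := (e1.mul e2).mul e3
  simpa only [NE_add, zero_add, add_zero, sub_add_cancel] using this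

lemma NT_mem (k : ℤ) : InK (NT k) :=
  InK_zpow NT NT_zero NT_add (InK.of (k_b13.mul k_bet) (by decide +kernel)) k

lemma NSwap_mem : InK NSwap := InK.of k_sig (by decide +kernel)

lemma NNegH_mem : InK NNegH :=
  InK.of (k_sig.mul (InH.mono (derive_shift H1_le H1_sh w_rho0 1 ![2, -2, 1, 0, -1] (by decide +kernel)) H14)) (by decide +kernel)

lemma NNegM_mem : InK NNegM := by
  have : InK (-1) := InK.of k_neg (by decide +kernel)
  have := this.mul NNegH_mem
  rwa [show -1 * NNegH = NNegM by decide +kernel] at this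

lemma NBet_mem : InK NBet := InK.of k_bet (by decide +kernel)
lemma NB2_mem : InK NB2 := InK.of k_b2 (by decide +kernel)
lemma Nt_mem : InK Nt :=
  InK.of (derive_refl H4_le H4_sh k_sig (w_rho.mono H14) 2 4 ![1, -1, 0, 0, 0] (by decide +kernel))
    (by decide +kernel)

/-! ### Orbits of vectors -/

def Orb (v w : V5) : Prop := ∃ N, InK N ∧ v ᵥ* N = w

lemma Orb.trans {u v w : V5} (h1 : Orb u v) (h2 : Orb v w) : Orb u w := by
  obtain ⟨N, hN, rfl⟩ := h1
  obtain ⟨N', hN', rfl⟩ := h2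
  exact ⟨N * N', hN.mul hN', by rw [vecMul_vecMul]⟩

/-- Isotropic vectors having inner product one with some vector. -/
def Good (v : V5) : Prop := v ⬝ᵥ (gJ *ᵥ v) = 0 ∧ ∃ u, v ⬝ᵥ (gJ *ᵥ u) = 1

lemma InK.pair {N : M5} (hN : InK N) (v w : V5) :
    (v ᵥ* N) ⬝ᵥ (gJ *ᵥ (w ᵥ* N)) = v ⬝ᵥ (gJ *ᵥ w) := by
  rw [← mulVec_transpose N w, mulVec_mulVec, ← dotProduct_mulVec, mulVec_mulVec, ← mul_assoc, hN.iso]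

lemma Good.orb {v w : V5} (h : Good v) (hvw : Orb v w) : Good w := by
  obtain ⟨N, hN, rfl⟩ := hvw
  obtain ⟨h1, u, hu⟩ := h
  exact ⟨by rw [hN.pair, h1], u ᵥ* N, by rw [hN.pair, hu]⟩

lemma pair_eq (p q a b c p' q' a' b' c' : ℤ) :
    (![p, q, a, b, c] : V5) ⬝ᵥ (gJ *ᵥ ![p', q', a', b', c']) =
      p * q' + q * p' + 3 * a * b' + 3 * b * a' + 2 * b * b' + 2 * c * c' := by
  simp [gJ, dotProduct, mulVec, Fin.sum_univ_five]
  ring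

lemma vec_eta (v : V5) : v = ![v 0, v 1, v 2, v 3, v 4] := by
  ext i; fin_cases i <;> rfl

lemma good_iff (p q a b c : ℤ) : Good ![p, q, a, b, c] ↔
    p * q + 3 * a * b + b ^ 2 + c ^ 2 = 0 ∧
    ∃ p' q' a' b' c' : ℤ, p * q' + q * p' + 3 * a * b' + 3 * b * a' + 2 * b * b' + 2 * c * c' = 1 := by
  unfold Good
  rw [pair_eq]
  refine and_congr ⟨fun h => by linarith, fun h => by linarith⟩ ?_
  constructor
  · rintro ⟨u, hu⟩
    rw [vec_eta u, pair_eq] at hu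
    exact ⟨_, _, _, _, _, hu⟩
  · rintro ⟨p', q', a', b', c', h⟩
    exact ⟨![p', q', a', b', c'], by rw [pair_eq, h]⟩

lemma vecMul_NE (p q a b c x y z : ℤ) : (![p, q, a, b, c] : V5) ᵥ* NE x y z =
    ![p - (3 * a * y + 3 * b * x + 2 * b * y + 2 * c * z) - (3 * x * y + y ^ 2 + z ^ 2) * q, q,
      a + x * q, b + y * q, c + z * q] := by
  ext i
  fin_cases i <;> simp [NE, vecMul, dotProduct, Fin.sum_univ_five] <;> ring

lemma vecMul_NT (p q a b c k : ℤ) : (![p, q, a, b, c] : V5) ᵥ* NT k =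
    ![p, q, a - 3 * k ^ 2 * b - 2 * k * c, b, c + 3 * k * b] := by
  ext i
  fin_cases i <;> simp [NT, vecMul, dotProduct, Fin.sum_univ_five] <;> ring

lemma vecMul_NSwap (p q a b c : ℤ) : (![p, q, a, b, c] : V5) ᵥ* NSwap = ![q, p, a, b, c] := by
  ext i
  fin_cases i <;> simp [NSwap, vecMul, dotProduct, Fin.sum_univ_five]

lemma vecMul_NNegH (p q a b c : ℤ) : (![p, q, a, b, c] : V5) ᵥ* NNegH = ![-p, -q, a, b, c] := by
  ext i
  fin_cases i <;> simp [NNegH, vecMul, dotProduct, Fin.sum_univ_five]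

lemma vecMul_NNegM (p q a b c : ℤ) :
    (![p, q, a, b, c] : V5) ᵥ* NNegM = ![p, q, -a, -b, -c] := by
  ext i
  fin_cases i <;> simp [NNegM, vecMul, dotProduct, Fin.sum_univ_five]

lemma vecMul_NBet (p q a b c : ℤ) : (![p, q, a, b, c] : V5) ᵥ* NBet = ![p, q, a, b, -c] := by
  ext i
  fin_cases i <;> simp [NBet, vecMul, dotProduct, Fin.sum_univ_five]

lemma vecMul_NB2 (p q a b c : ℤ) :
    (![p, q, a, b, c] : V5) ᵥ* NB2 = ![p, q, a, -3 * a - b, c] := by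
  ext i
  fin_cases i <;> simp [NB2, vecMul, dotProduct, Fin.sum_univ_five]
  ring

lemma vecMul_Nt (p q a b c : ℤ) : (![p, q, a, b, c] : V5) ᵥ* Nt =
    ![p, q, -2 * a + b + 2 * c, 3 * a - 2 * c, -3 * a + b + 3 * c] := by
  ext i
  fin_cases i <;> simp [Nt, vecMul, dotProduct, Fin.sum_univ_five] <;> ring

lemma orb_E (p q a b c x y z : ℤ) : Orb ![p, q, a, b, c]
    ![p - (3 * a * y + 3 * b * x + 2 * b * y + 2 * c * z) - (3 * x * y + y ^ 2 + z ^ 2) * q, q,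
      a + x * q, b + y * q, c + z * q] :=
  ⟨_, NE_mem x y z, vecMul_NE ..⟩

lemma orb_swap (p q a b c : ℤ) : Orb ![p, q, a, b, c] ![q, p, a, b, c] :=
  ⟨_, NSwap_mem, vecMul_NSwap ..⟩

lemma orb_F (p q a b c x y z : ℤ) : Orb ![p, q, a, b, c]
    ![p, q - (3 * a * y + 3 * b * x + 2 * b * y + 2 * c * z) - (3 * x * y + y ^ 2 + z ^ 2) * p,
      a + x * p, b + y * p, c + z * p] :=
  ((orb_swap ..).trans (orb_E q p a b c x y z)).trans (orb_swap ..)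

/-! ### Arithmetic lemmas -/

/-- Balanced remainders. -/
lemma exists_balanced (a m : ℤ) (hm : m ≠ 0) : ∃ x : ℤ, 2 * |a + x * m| ≤ |m| := by
  refine ⟨-round ((a : ℚ) / m), ?_⟩
  have h := abs_sub_round ((a : ℚ) / m)
  have hm' : (m : ℚ) ≠ 0 := by exact_mod_cast hm
  have hpos : (0 : ℚ) < |(m : ℚ)| := abs_pos.2 hm'
  have e : ((a : ℚ) + (-round ((a : ℚ) / m) : ℤ) * m) = ((a : ℚ) / m - round ((a : ℚ) / m)) * m := by
    push_cast; field_simp; ring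
  have : (2 : ℚ) * |(a : ℚ) + (-round ((a : ℚ) / m) : ℤ) * m| ≤ |(m : ℚ)| := by
    rw [e, abs_mul]; nlinarith
  exact_mod_cast this

/-- Reduction of the ternary part modulo `p`. -/
lemma exists_reduced (p a b c : ℤ) (hp : p ≠ 0) : ∃ x y z : ℤ,
    2 * |b + y * p| ≤ |p| ∧ (b + y * p = 0 → 2 * |a + x * p| ≤ |p|) ∧
    |3 * (a + x * p) * (b + y * p) + (b + y * p) ^ 2 + (c + z * p) ^ 2| < p ^ 2 := by
  obtain ⟨x, hx⟩ := exists_balanced a p hp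
  obtain ⟨y, hy⟩ := exists_balanced b p hp
  obtain ⟨z, hz⟩ := exists_balanced c p hp
  generalize hB : b + y * p = B at hy
  generalize hC : c + z * p = C at hz
  by_cases hlt : |3 * (a + x * p) * B + B ^ 2 + C ^ 2| < p ^ 2
  · exact ⟨x, y, z, by rw [hB]; exact hy, fun _ => hx, by rw [hB, hC]; exact hlt⟩
  generalize hA : a + x * p = A at hx hlt
  have hP : 0 < |p| := abs_pos.2 hp
  have hpp : p ^ 2 = |p| ^ 2 := (sq_abs p).symm
  have hB2 : B ^ 2 = |B| ^ 2 := (sq_abs B).symm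
  have hC2 : C ^ 2 = |C| ^ 2 := (sq_abs C).symm
  have hAB : |A * B| = |A| * |B| := abs_mul A B
  have hA0 := abs_nonneg A
  have hB0 := abs_nonneg B
  have hC0 := abs_nonneg C
  have hC4 : 4 * |C| ^ 2 ≤ |p| ^ 2 := by nlinarith
  have hB4 : 4 * |B| ^ 2 ≤ |p| ^ 2 := by nlinarith
  have hAB4 : 4 * (|A| * |B|) ≤ |p| ^ 2 := by nlinarith
  have hpos : 0 < A * B := by
    by_contra hneg
    push Not at hneg
    apply hlt
    rw [abs_lt]
    have : A * B = -(|A| * |B|) := by rw [← hAB, abs_of_nonpos hneg]; ring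
    constructor <;> nlinarith
  have hABe : A * B = |A| * |B| := by rw [← hAB, abs_of_pos hpos]
  have hge : p ^ 2 ≤ 3 * A * B + B ^ 2 + C ^ 2 := by
    rw [not_lt, le_abs] at hlt
    rcases hlt with h | h
    · exact h
    · nlinarith
  have hBne : B ≠ 0 := by rintro rfl; simp at hpos
  have hBpos : 0 < |B| := abs_pos.2 hBne
  -- choose the sign
  obtain ⟨s, hs⟩ : ∃ s : ℤ, s * p * B = -(|p| * |B|) := by
    rcases le_or_gt 0 (p * B) with h | h
    · exact ⟨-1, by rw [← abs_mul, abs_of_nonneg h]; ring⟩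
    · exact ⟨1, by rw [← abs_mul, abs_of_neg h]; ring⟩
  have h3 : |p| ≤ 3 * |A| := by
    have : 2 * |p| ^ 2 ≤ 12 * (|A| * |B|) := by nlinarith
    nlinarith
  refine ⟨x + s, y, z, by rw [hB]; exact hy, fun h => absurd (hB.symm.trans h) hBne, ?_⟩
  rw [hB, hC, show a + (x + s) * p = A + s * p by rw [← hA]; ring]
  have e : 3 * (A + s * p) * B + B ^ 2 + C ^ 2 =
      3 * (|A| * |B|) - 3 * (|p| * |B|) + |B| ^ 2 + |C| ^ 2 := by
    rw [← hABe, ← hB2, ← hC2]; linear_combination 3 * hs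
  rw [e, hpp, abs_lt]
  constructor
  · nlinarith
  · nlinarith

lemma three_dvd_of_sq {b c : ℤ} (h : (3 : ℤ) ∣ b ^ 2 + c ^ 2) : (3 : ℤ) ∣ b ∧ (3 : ℤ) ∣ c := by
  have hb : b % 3 = 0 ∨ b % 3 = 1 ∨ b % 3 = 2 := by omega
  have hc : c % 3 = 0 ∨ c % 3 = 1 ∨ c % 3 = 2 := by omega
  have h' := Int.emod_eq_zero_of_dvd h
  rcases hb with hb | hb | hb <;> rcases hc with hc | hc | hc <;>
    simp [pow_two, Int.add_emod, Int.mul_emod, hb, hc] at h' <;>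
    exact ⟨Int.dvd_of_emod_eq_zero hb, Int.dvd_of_emod_eq_zero hc⟩

/-! ### First step: transitivity on good isotropic vectors -/

lemma step1 : ∀ (n : ℕ) (p q a b c : ℤ), p.natAbs = n → p ≠ 0 → Good ![p, q, a, b, c] →
    Orb ![p, q, a, b, c] ![1, 0, 0, 0, 0] := by
  intro n
  induction n using Nat.strong_induction_on with
  | _ n ih =>
  intro p q a b c hpn hp hgood
  have IH : ∀ p' q' a' b' c' : ℤ, |p'| < |p| → p' ≠ 0 →
      Orb ![p, q, a, b, c] ![p', q', a', b', c'] → Orb ![p, q, a, b, c] ![1, 0, 0, 0, 0] := by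
    intro p' q' a' b' c' hlt hne horb
    exact horb.trans (ih p'.natAbs (by rw [← hpn]; exact Int.natAbs_lt_iff_sq_lt.2 (sq_lt_sq.2 hlt)) p' q' a' b' c' rfl hne (hgood.orb horb))
  obtain ⟨x, y, z, hb, ha, hlt⟩ := exists_reduced p a b c hp
  have horb := orb_F p q a b c x y z
  generalize q - (3 * a * y + 3 * b * x + 2 * b * y + 2 * c * z) -
    (3 * x * y + y ^ 2 + z ^ 2) * p = q' at horb
  generalize a + x * p = a' at *
  generalize b + y * p = b' at *
  generalize c + z * p = c' at *
  have hg := hgood.orb horb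
  obtain ⟨hiso, p2, q2, a2, b2, c2, hpair⟩ := (good_iff ..).1 hg
  have hP : 0 < |p| := abs_pos.2 hp
  have hq' : |q'| < |p| := by
    have : |p * q'| < p ^ 2 := by
      rwa [show p * q' = -(3 * a' * b' + b' ^ 2 + c' ^ 2) by linarith, abs_neg]
    rw [abs_mul, ← sq_abs p] at this
    nlinarith
  by_cases hq0 : q' = 0
  swap
  · exact IH q' p a' b' c' hq' hq0 (horb.trans (orb_swap ..))
  subst hq0
  have h3 : (3 : ℤ) ∣ b' ^ 2 + c' ^ 2 := ⟨-(a' * b'), by linarith⟩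
  obtain ⟨h3b, h3c⟩ := three_dvd_of_sq h3
  have h3p : ¬ (3 : ℤ) ∣ p := by
    rintro ⟨p3, rfl⟩
    obtain ⟨b3, rfl⟩ := h3b
    obtain ⟨c3, rfl⟩ := h3c
    have : (3 : ℤ) ∣ 1 := ⟨p3 * q2 + a' * b2 + 3 * b3 * a2 + 2 * b3 * b2 + 2 * c3 * c2, by
      rw [← hpair]; ring⟩
    omega
  by_cases hb0 : b' = 0
  swap
  · obtain ⟨k, hk⟩ := exists_balanced p (3 * b') (by omega)
    have h := orb_E p 0 a' b' c' (-k) 0 0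
    refine IH _ _ _ _ _ ?_ ?_ (horb.trans h)
    · rw [show p - (3 * a' * 0 + 3 * b' * -k + 2 * b' * 0 + 2 * c' * 0) -
        (3 * -k * 0 + 0 ^ 2 + 0 ^ 2) * 0 = p + k * (3 * b') by ring]
      rw [abs_mul, show |(3 : ℤ)| = 3 from rfl] at hk
      omega
    · intro h0
      exact h3p ⟨-(k * b'), by linarith⟩
  subst hb0
  have hc0 : c' = 0 := by nlinarith [sq_nonneg c']
  subst hc0
  have ha' := ha rfl
  by_cases ha0 : a' = 0
  swap
  · obtain ⟨k, hk⟩ := exists_balanced p (3 * a') (by omega)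
    have h := orb_E p 0 a' 0 0 0 (-k) 0
    refine IH _ _ _ _ _ ?_ ?_ (horb.trans h)
    · rw [show p - (3 * a' * -k + 3 * 0 * 0 + 2 * 0 * -k + 2 * 0 * 0) -
        (3 * 0 * -k + (-k) ^ 2 + 0 ^ 2) * 0 = p + k * (3 * a') by ring]
      rw [abs_mul, show |(3 : ℤ)| = 3 from rfl] at hk
      omega
    · intro h0
      exact h3p ⟨-(k * a'), by linarith⟩
  subst ha0
  have h1 : p * q2 = 1 := by linarith
  rcases Int.eq_one_or_neg_one_of_mul_eq_one h1 with rfl | rfl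
  · exact horb
  · refine horb.trans ⟨_, NNegH_mem, ?_⟩
    rw [vecMul_NNegH]; simp

lemma step1' (v : V5) (h : Good v) : Orb v ![1, 0, 0, 0, 0] := by
  rw [vec_eta v] at *
  generalize v 0 = p, v 1 = q, v 2 = a, v 3 = b, v 4 = c at *
  by_cases hp : p = 0
  swap
  · exact step1 _ p q a b c rfl hp h
  subst hp
  by_cases hq : q = 0
  swap
  · have hs := orb_swap 0 q a b c
    exact hs.trans (step1 _ q 0 a b c rfl hq (h.orb hs))
  subst hq
  obtain ⟨hiso, p2, q2, a2, b2, c2, hpair⟩ := (good_iff ..).1 h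
  have hs := orb_E 0 0 a b c a2 b2 c2
  refine hs.trans (step1 _ _ _ _ _ _ rfl ?_ (h.orb hs))
  intro h0
  linarith

/-! ### Second descent, in the ternary lattice -/

/-- Orbits under the stabilizer of the hyperbolic plane. -/
def OrbM (v w : V5) : Prop := ∃ N, InK N ∧ (![1, 0, 0, 0, 0] : V5) ᵥ* N = ![1, 0, 0, 0, 0] ∧
  (![0, 1, 0, 0, 0] : V5) ᵥ* N = ![0, 1, 0, 0, 0] ∧ v ᵥ* N = w

lemma OrbM.trans {u v w : V5} (h1 : OrbM u v) (h2 : OrbM v w) : OrbM u w := by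
  obtain ⟨N, hN, he, hf, rfl⟩ := h1
  obtain ⟨N', hN', he', hf', rfl⟩ := h2
  exact ⟨N * N', hN.mul hN', by rw [← vecMul_vecMul, he, he'],
    by rw [← vecMul_vecMul, hf, hf'], by rw [vecMul_vecMul]⟩

lemma orbM_T (a b c k : ℤ) :
    OrbM ![0, 0, a, b, c] ![0, 0, a - 3 * k ^ 2 * b - 2 * k * c, b, c + 3 * k * b] :=
  ⟨_, NT_mem k, by rw [vecMul_NT]; simp, by rw [vecMul_NT]; simp, vecMul_NT ..⟩

lemma orbM_Bet (a b c : ℤ) : OrbM ![0, 0, a, b, c] ![0, 0, a, b, -c] :=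
  ⟨_, NBet_mem, by rw [vecMul_NBet]; simp, by rw [vecMul_NBet]; simp, vecMul_NBet ..⟩

lemma orbM_neg (a b c : ℤ) : OrbM ![0, 0, a, b, c] ![0, 0, -a, -b, -c] :=
  ⟨_, NNegM_mem, by rw [vecMul_NNegM]; simp, by rw [vecMul_NNegM]; simp, vecMul_NNegM ..⟩

lemma orbM_B2 (a b c : ℤ) : OrbM ![0, 0, a, b, c] ![0, 0, a, -3 * a - b, c] :=
  ⟨_, NB2_mem, by rw [vecMul_NB2]; simp, by rw [vecMul_NB2]; simp, vecMul_NB2 ..⟩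

lemma orbM_t (a b c : ℤ) : OrbM ![0, 0, a, b, c]
    ![0, 0, -2 * a + b + 2 * c, 3 * a - 2 * c, -3 * a + b + 3 * c] :=
  ⟨_, Nt_mem, by rw [vecMul_Nt]; simp, by rw [vecMul_Nt]; simp, vecMul_Nt ..⟩

lemma step3 : ∀ (n : ℕ) (a b c : ℤ), b.natAbs = n → 3 * a * b + b ^ 2 + c ^ 2 = 0 →
    ∃ a', OrbM ![0, 0, a, b, c] ![0, 0, a', 0, 0] := by
  intro n
  induction n using Nat.strong_induction_on with
  | _ n ih =>
  intro a b c hbn hiso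
  by_cases hb : b = 0
  · subst hb
    have hc : c = 0 := by nlinarith [sq_nonneg c]
    subst hc
    exact ⟨a, ⟨1, InK.one, by simp, by simp, by simp⟩⟩
  obtain ⟨k, hk⟩ := exists_balanced c (3 * b) (by omega)
  have h1 := orbM_T a b c k
  rw [show c + 3 * k * b = c + k * (3 * b) by ring] at h1
  have hiso1 : 3 * (a - 3 * k ^ 2 * b - 2 * k * c) * b + b ^ 2 + (c + k * (3 * b)) ^ 2 = 0 := by
    linear_combination hiso
  generalize a - 3 * k ^ 2 * b - 2 * k * c = a1 at *
  generalize c + k * (3 * b) = c1 at *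
  rw [abs_mul, show |(3 : ℤ)| = 3 from rfl] at hk
  by_cases hc1 : c1 = 0
  · subst hc1
    have h2 : 3 * a1 + b = 0 := by
      have : b * (3 * a1 + b) = 0 := by linarith
      exact (mul_eq_zero.1 this).resolve_left hb
    have h3 := orbM_B2 a1 b 0
    rw [show -3 * a1 - b = 0 by linarith] at h3
    exact ⟨_, h1.trans h3⟩
  -- make the signs of `b` and `c` opposite
  obtain ⟨c2, hc2, hs, h2⟩ : ∃ c2 : ℤ, |c2| = |c1| ∧ b * c2 = -(|b| * |c1|) ∧
      OrbM ![0, 0, a, b, c] ![0, 0, a1, b, c2] := by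
    rcases le_or_gt 0 (b * c1) with h | h
    · refine ⟨-c1, abs_neg _, ?_, h1.trans (orbM_Bet ..)⟩
      rw [← abs_mul, abs_of_nonneg h]; ring
    · refine ⟨c1, rfl, ?_, h1⟩
      rw [← abs_mul, abs_of_neg h]; ring
  have hcc : c2 ^ 2 = c1 ^ 2 := by rw [← sq_abs c2, hc2, sq_abs]
  have h3 := h2.trans (orbM_t a1 b c2)
  have hB : 0 < |b| := abs_pos.2 hb
  have hC : 0 < |c1| := abs_pos.2 hc1
  have hlt : |3 * a1 - 2 * c2| < |b| := by
    have e : b * (3 * a1 - 2 * c2) = -(|b| - |c1|) ^ 2 := by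
      have e1 := sq_abs b
      have e2 := sq_abs c1
      nlinarith
    have : |b| * |3 * a1 - 2 * c2| < |b| * |b| := by
      rw [← abs_mul, e, abs_neg, abs_of_nonneg (sq_nonneg _)]
      nlinarith
    exact lt_of_mul_lt_mul_left this hB.le
  obtain ⟨a', ha'⟩ := ih (3 * a1 - 2 * c2).natAbs
    (by rw [← hbn]; exact Int.natAbs_lt_iff_sq_lt.2 (sq_lt_sq.2 hlt)) (-2 * a1 + b + 2 * c2)
    (3 * a1 - 2 * c2) (-3 * a1 + b + 3 * c2) rfl (by linear_combination hiso1 + hcc)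
  exact ⟨a', h3.trans ha'⟩

/-! ### Every isometry lies in `H4` -/

lemma row_pair {N : M5} (hN : N * gJ * Nᵀ = gJ) (i j : Fin 5) :
    N i ⬝ᵥ (gJ *ᵥ N j) = gJ i j := by
  have := congrFun (congrFun hN i) j
  rw [← this, dotProduct_mulVec]
  rfl

lemma InK.cancel {N h : M5} (h1 : InK (N * h)) (h2 : InK h) : InK N := by
  obtain ⟨g1, hg1, e1⟩ := h1
  obtain ⟨g, hg, e2⟩ := h2
  refine ⟨g1 * g⁻¹, H4.mul_mem hg1 (H4.inv_mem hg), ?_⟩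
  have e3 : g1.val = (basInv * N * bas) * g.val := by
    rw [e1, e2, show basInv * N * bas * (basInv * h * bas) =
      basInv * N * (bas * basInv) * h * bas by simp only [mul_assoc], bas_mul, mul_one,
      mul_assoc basInv N h]
  rw [Units.val_mul, e3, mul_assoc, ← Units.val_mul, mul_inv_cancel, Units.val_one, mul_one]

lemma iso_mul {N h : M5} (hN : N * gJ * Nᵀ = gJ) (hh : InK h) : (N * h) * gJ * (N * h)ᵀ = gJ := by
  rw [transpose_mul, show N * h * gJ * (hᵀ * Nᵀ) = N * (h * gJ * hᵀ) * Nᵀ by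
    simp only [mul_assoc], hh.iso, hN]

lemma row_mul (N h : M5) (i : Fin 5) : (N * h) i = N i ᵥ* h := rfl

/-- Rows, their coordinates and the corresponding inner products. -/
lemma row_pair' {N : M5} (hN : N * gJ * Nᵀ = gJ) (i j : Fin 5) :
    N i 0 * N j 1 + N i 1 * N j 0 + 3 * N i 2 * N j 3 + 3 * N i 3 * N j 2 + 2 * N i 3 * N j 3 +
      2 * N i 4 * N j 4 = gJ i j := by
  rw [← row_pair hN i j, vec_eta (N i), vec_eta (N j), pair_eq]
  rfl

lemma row_eq {N : M5} {i : Fin 5} {p q a b c : ℤ} (h : N i = ![p, q, a, b, c]) :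
    N i 0 = p ∧ N i 1 = q ∧ N i 2 = a ∧ N i 3 = b ∧ N i 4 = c := by
  rw [h]; exact ⟨rfl, rfl, rfl, rfl, rfl⟩

lemma row_mk {N : M5} {i : Fin 5} {p q a b c : ℤ} (h0 : N i 0 = p) (h1 : N i 1 = q)
    (h2 : N i 2 = a) (h3 : N i 3 = b) (h4 : N i 4 = c) : N i = ![p, q, a, b, c] := by
  rw [vec_eta (N i), h0, h1, h2, h3, h4]

/-- A row orthogonal to the first two basis vectors. -/
lemma row_perp {N : M5} (hN : N * gJ * Nᵀ = gJ) (h0 : N 0 = ![1, 0, 0, 0, 0])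
    (h1 : N 1 = ![0, 1, 0, 0, 0]) (i : Fin 5) (hi : 2 ≤ i) :
    N i = ![0, 0, N i 2, N i 3, N i 4] := by
  have g0 : ∀ i : Fin 5, 2 ≤ i → gJ 0 i = 0 ∧ gJ 1 i = 0 := by decide +kernel
  have e0 := row_pair' hN 0 i
  have e1 := row_pair' hN 1 i
  obtain ⟨a0, a1, a2, a3, a4⟩ := row_eq h0
  obtain ⟨c0, c1, c2, c3, c4⟩ := row_eq h1
  rw [a0, a1, a2, a3, a4, (g0 i hi).1] at e0
  rw [c0, c1, c2, c3, c4, (g0 i hi).2] at e1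
  exact row_mk (by linarith) (by linarith) rfl rfl rfl

lemma stage5 {N : M5} (hN : N * gJ * Nᵀ = gJ) (h0 : N 0 = ![1, 0, 0, 0, 0])
    (h1 : N 1 = ![0, 1, 0, 0, 0]) (h2 : N 2 = ![0, 0, 1, 0, 0]) (h3 : N 3 = ![0, 0, 0, 1, 0]) :
    InK N := by
  have h4 := row_perp hN h0 h1 4 (by decide)
  obtain ⟨a0, a1, a2, a3, a4⟩ := row_eq h2
  obtain ⟨c0, c1, c2, c3, c4⟩ := row_eq h3
  have e2 := row_pair' hN 2 4
  have e3 := row_pair' hN 3 4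
  have e4 := row_pair' hN 4 4
  rw [a0, a1, a2, a3, a4, show gJ 2 4 = 0 by decide +kernel] at e2
  rw [c0, c1, c2, c3, c4, show gJ 3 4 = 0 by decide +kernel] at e3
  have hb : N 4 3 = 0 := by linarith
  have ha : N 4 2 = 0 := by linarith
  rw [hb, ha, (row_eq h4).1, (row_eq h4).2.1, show gJ 4 4 = 2 by decide +kernel] at e4
  have hc : N 4 4 * N 4 4 = 1 := by linarith
  rw [ha, hb] at h4
  rcases Int.eq_one_or_neg_one_of_mul_eq_one hc with h | h <;> rw [h] at h4
  · have : N = 1 := by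
      ext i j
      have : N i j = (N i) j := rfl
      fin_cases i <;> fin_cases j <;> simp [h0, h1, h2, h3, h4]
    rw [this]; exact InK.one
  · have : N = NBet := by
      ext i j
      fin_cases i <;> fin_cases j <;> simp [h0, h1, h2, h3, h4, NBet]
    rw [this]; exact NBet_mem

lemma stage4 {N : M5} (hN : N * gJ * Nᵀ = gJ) (h0 : N 0 = ![1, 0, 0, 0, 0])
    (h1 : N 1 = ![0, 1, 0, 0, 0]) (h2 : N 2 = ![0, 0, 1, 0, 0]) : InK N := by
  have h3 := row_perp hN h0 h1 3 (by decide)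
  obtain ⟨a0, a1, a2, a3, a4⟩ := row_eq h2
  have e2 := row_pair' hN 2 3
  have e3 := row_pair' hN 3 3
  rw [a0, a1, a2, a3, a4, show gJ 2 3 = 3 by decide +kernel] at e2
  have hb : N 3 3 = 1 := by linarith
  rw [hb, (row_eq h3).1, (row_eq h3).2.1, show gJ 3 3 = 2 by decide +kernel] at e3
  rw [hb] at h3
  generalize N 3 2 = a at *
  generalize N 3 4 = c at *
  have h3c : (3 : ℤ) ∣ c := Int.prime_three.dvd_of_dvd_pow (n := 2) ⟨-a, by linarith⟩
  obtain ⟨k, rfl⟩ := h3c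
  refine InK.cancel (h := NT (-k)) (stage5 (iso_mul hN (NT_mem _)) ?_ ?_ ?_ ?_) (NT_mem _) <;>
    rw [row_mul]
  · rw [h0, vecMul_NT]; simp
  · rw [h1, vecMul_NT]; simp
  · rw [h2, vecMul_NT]; simp
  · have ha : a = -3 * k ^ 2 := by linarith
    rw [h3, vecMul_NT, ha]
    congr 3
    · ring
    · ring_nf

lemma stage3 {N : M5} (hN : N * gJ * Nᵀ = gJ) (h0 : N 0 = ![1, 0, 0, 0, 0])
    (h1 : N 1 = ![0, 1, 0, 0, 0]) : InK N := by
  have h2 := row_perp hN h0 h1 2 (by decide)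
  have e2 := row_pair' hN 2 2
  rw [(row_eq h2).1, (row_eq h2).2.1, show gJ 2 2 = 0 by decide +kernel] at e2
  obtain ⟨a', N', hN', he, hf, hv⟩ := step3 _ (N 2 2) (N 2 3) (N 2 4) rfl (by linarith)
  rw [← h2] at hv
  refine InK.cancel (h := N') ?_ hN'
  have hM := iso_mul hN hN'
  have m0 : (N * N') 0 = ![1, 0, 0, 0, 0] := by rw [row_mul, h0, he]
  have m1 : (N * N') 1 = ![0, 1, 0, 0, 0] := by rw [row_mul, h1, hf]
  have m2 : (N * N') 2 = ![0, 0, a', 0, 0] := by rw [row_mul, hv]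
  generalize N * N' = M at *
  have e3 := row_pair' hM 2 3
  obtain ⟨a0, a1, a2, a3, a4⟩ := row_eq m2
  rw [a0, a1, a2, a3, a4, show gJ 2 3 = 3 by decide +kernel] at e3
  have hu : a' * M 3 3 = 1 := by linarith
  rcases Int.eq_one_or_neg_one_of_mul_eq_one hu with rfl | rfl
  · exact stage4 hM m0 m1 m2
  · refine InK.cancel (h := NNegM) (stage4 (iso_mul hM NNegM_mem) ?_ ?_ ?_) NNegM_mem <;>
      rw [row_mul]
    · rw [m0, vecMul_NNegM]; simp
    · rw [m1, vecMul_NNegM]; simp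
    · rw [m2, vecMul_NNegM]; simp

lemma stage2 {N : M5} (hN : N * gJ * Nᵀ = gJ) (h0 : N 0 = ![1, 0, 0, 0, 0]) : InK N := by
  obtain ⟨a0, a1, a2, a3, a4⟩ := row_eq h0
  have e0 := row_pair' hN 0 1
  have e1 := row_pair' hN 1 1
  rw [a0, a1, a2, a3, a4, show gJ 0 1 = 1 by decide +kernel] at e0
  have hq : N 1 1 = 1 := by linarith
  have h1 := vec_eta (N 1)
  rw [hq] at h1
  rw [hq, show gJ 1 1 = 0 by decide +kernel] at e1
  generalize N 1 0 = p at *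
  generalize N 1 2 = a at *
  generalize N 1 3 = b at *
  generalize N 1 4 = c at *
  refine InK.cancel (h := NE (-a) (-b) (-c)) (stage3 (iso_mul hN (NE_mem _ _ _)) ?_ ?_)
    (NE_mem _ _ _) <;> rw [row_mul]
  · rw [h0, vecMul_NE]; simp
  · rw [h1, vecMul_NE]
    have hp : p = -(3 * a * b + b ^ 2 + c ^ 2) := by linarith
    congr 1
    · rw [hp]; ring
    · simp

lemma all_InK {N : M5} (hN : N * gJ * Nᵀ = gJ) : InK N := by
  have hg : Good (N 0) := ⟨by rw [row_pair hN]; decide +kernel, N 1, by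
    rw [row_pair hN]; decide +kernel⟩
  obtain ⟨N', hN', hv⟩ := step1' _ hg
  exact InK.cancel (stage2 (iso_mul hN hN') (by rw [row_mul, hv])) hN'

lemma orth_le : orthogonalSubgroup matQ ≤ H4 := by
  intro g hg
  have h1 := (mem_orth_iff g).1 hg
  have e : basInv * (bas * g.val * basInv) * bas = g.val := by
    rw [show basInv * (bas * g.val * basInv) * bas = (basInv * bas) * g.val * (basInv * bas) by
      simp only [mul_assoc], basInv_mul, one_mul, mul_one]
  have h2 := all_InK ((iso_iff _ _ e).2 h1)
  unfold InK at h2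
  rw [e] at h2
  exact h2.mem

lemma relIndex_final : H0.relIndex (orthogonalSubgroup matQ) ≠ 0 := by
  rw [le_antisymm orth_le H4_le]
  exact relIndex04

lemma closure_eq (A B : GL (Fin 5) ℤ) (hA : (A : M5) = matA) (hB : (B : M5) = matB) :
    Subgroup.closure {A, B} = H0 := by
  have eA : A = uA := Units.ext (hA.trans (by change matA = shM 4; decide +kernel))
  have eB : B = uA * uC := Units.ext (hB.trans (by
    change matB = shM 4 * S 1 ![0, 0, 0, 0, 1]; decide +kernel))
  subst eA eB
  apply le_antisymm
  · refine (Subgroup.closure_le _).2 ?_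
    have h1 : uA ∈ H0 := Subgroup.subset_closure (by simp [s0])
    have h2 : uC ∈ H0 := Subgroup.subset_closure (by simp [s0])
    rintro x (rfl | rfl)
    · exact h1
    · exact H0.mul_mem h1 h2
  · refine (Subgroup.closure_le _).2 ?_
    have h1 : uA ∈ Subgroup.closure {uA, uA * uC} := Subgroup.subset_closure (by simp)
    have h2 : uA * uC ∈ Subgroup.closure {uA, uA * uC} := Subgroup.subset_closure (by simp)
    rintro x (rfl | rfl)
    · exact h1
    · have := Subgroup.mul_mem _ (Subgroup.inv_mem _ h1) h2
      rwa [inv_mul_cancel_left] at this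

end Hyp

/-- Case 13 of Theorem 1.2: the hypergeometric group `Γ(f,g)` generated by the companion matrices `A`, `B`
of `f(x) = x^5 - 1` and `g(x) = x^5 + 3*x^4 + 5*x^3 + 5*x^2 + 3*x + 1`
is an arithmetic subgroup of `O_Q(ℤ)`: it preserves `Q`, it is contained in `O_Q(ℤ)`,
and it has finite index in `O_Q(ℤ)`. -/
theorem hypergeometric_group_arithmetic
    (A B : GL (Fin 5) ℤ)
    (hA : (A : Matrix (Fin 5) (Fin 5) ℤ) = matA)
    (hB : (B : Matrix (Fin 5) (Fin 5) ℤ) = matB) :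
    matAᵀ * matQ * matA = matQ ∧
    matBᵀ * matQ * matB = matQ ∧
    Subgroup.closure {A, B} ≤ orthogonalSubgroup matQ ∧
    ((Subgroup.closure {A, B}).subgroupOf (orthogonalSubgroup matQ)).FiniteIndex := by
  refine ⟨by decide +kernel, by decide +kernel, ?_, ?_⟩
  · rw [Hyp.closure_eq A B hA hB]; exact Hyp.H0_le
  · rw [Hyp.closure_eq A B hA hB]; exact ⟨Hyp.relIndex_final⟩
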